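/- Let C be a bounded open convex subset of ℝ² whose Hilbert metric space (C, d_C) is δ-hyperbolic for some δ ≥ 0. Then the boundary ∂C is of class C¹ and C is strictly convex (for any two distinct boundary points, the open segment joining them is contained in C). -/

import Mathlib

open MeasureTheory Set Filter
open scoped ENNReal NNReal

noncomputable section

/-- Euclidean `n`-space. -/
abbrev Euc (n : ℕ) : Type := EuclideanSpace ℝ (Fin n)

/-- The set of parameters `t` such that `p + t • v` lies in `C`. For `C` open bounded
convex, `p ∈ C` and `v ≠ 0` this is an open interval `(t⁻, t⁺)` with `t⁻ < 0 < t⁺`;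
the points `p + t⁻ • v` and `p + t⁺ • v` are the two intersections of the boundary `∂C`
with the line through `p` directed by `v`. -/
def lineParams {n : ℕ} (C : Set (Euc n)) (p v : Euc n) : Set ℝ := {t : ℝ | p + t • v ∈ C}

open Classical in
/-- The Hilbert distance of the convex set `C`: with `a = p + t⁻ • (q - p)` and
`b = p + t⁺ • (q - p)` the two boundary points (so that `a, p, q, b` are in this order),
the cross-ratio `(‖q-a‖ ‖p-b‖)/(‖p-a‖ ‖q-b‖)` equals `((1 - t⁻) t⁺)/((-t⁻)(t⁺ - 1))`. -/
def hDist {n : ℕ} (C : Set (Euc n)) (p q : Euc n) : ℝ :=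
  if p = q then 0
  else
    (1 / 2) * Real.log
      (((1 - sInf (lineParams C p (q - p))) * sSup (lineParams C p (q - p))) /
        ((-sInf (lineParams C p (q - p))) * (sSup (lineParams C p (q - p)) - 1)))

open Classical in
/-- The Hilbert Finsler norm of `u` at `p`: with `p⁺ = p + t⁺ • u`, `p⁻ = p + t⁻ • u`
the two boundary points on the line through `p` directed by `u`, one has
`(1/2)‖u‖(1/‖p-p⁺‖ + 1/‖p-p⁻‖) = (1/2)(1/t⁺ - 1/t⁻)`. -/
def fNorm {n : ℕ} (C : Set (Euc n)) (p u : Euc n) : ℝ :=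
  if u = 0 then 0
  else (1 / 2) * (1 / sSup (lineParams C p u) - 1 / sInf (lineParams C p u))

/-- The dual norm of a linear form `l` at `p`: `sup {l u : ‖u‖_{C,p} = 1}`. -/
def dualNorm {n : ℕ} (C : Set (Euc n)) (p : Euc n) (l : Euc n →L[ℝ] ℝ) : ℝ :=
  sSup ((fun u => l u) '' {u : Euc n | fNorm C p u = 1})

/-- The tangent ball `TB_R(p) = {u : ‖u‖_{C,p} < R}`. -/
def tangentBall {n : ℕ} (C : Set (Euc n)) (p : Euc n) (R : ℝ) : Set (Euc n) :=
  {u : Euc n | fNorm C p u < R}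

/-- `ωₙ`, the Lebesgue volume of the Euclidean unit ball of `ℝⁿ`. -/
def omegaVol (n : ℕ) : ℝ := (volume (Metric.ball (0 : Euc n) 1)).toReal

/-- The Hilbert (Busemann) measure of `C`: density `ωₙ / vol_e(TB_C(p))` against
Lebesgue measure, supported on `C`. -/
def hMeasure {n : ℕ} (C : Set (Euc n)) : Measure (Euc n) :=
  (volume.restrict C).withDensity fun p =>
    ENNReal.ofReal (omegaVol n / (volume (tangentBall C p 1)).toReal)

/-- Admissible test functions: nonzero Lipschitz functions with compact support
contained in `Ω`. -/
def testFuns {n : ℕ} (Ω : Set (Euc n)) : Set (Euc n → ℝ) :=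
  {f : Euc n → ℝ |
    (∃ K : ℝ≥0, LipschitzWith K f) ∧ f ≠ 0 ∧ HasCompactSupport f ∧ tsupport f ⊆ Ω}

/-- The Rayleigh quotient of `f` on `Ω`, with respect to the Hilbert geometry of `C`
(`df` is the a.e.-defined differential of the Lipschitz function `f`). -/
def rayleigh {n : ℕ} (C Ω : Set (Euc n)) (f : Euc n → ℝ) : ℝ :=
  (∫ p in Ω, dualNorm C p (fderiv ℝ f p) ^ 2 ∂hMeasure C) /
    ∫ p in Ω, f p ^ 2 ∂hMeasure C

/-- The Dirichlet bottom of the spectrum `λ₁^C(Ω)`. -/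
def lambda1D {n : ℕ} (C Ω : Set (Euc n)) : ℝ := sInf (rayleigh C Ω '' testFuns Ω)

/-- The bottom of the spectrum `λ₁(C)` of the Hilbert geometry of `C`. -/
def lambda1 {n : ℕ} (C : Set (Euc n)) : ℝ := lambda1D C C

/-- The Gromov product `(x|y)_t = (d(x,t) + d(y,t) - d(x,y))/2`. -/
def gromovProd {n : ℕ} (d : Euc n → Euc n → ℝ) (x y t : Euc n) : ℝ :=
  (d x t + d y t - d x y) / 2

/-- `(C, d_C)` is `δ`-hyperbolic: for all `x y z t` in `C`,
`(x|y)_t ≥ min((x|z)_t, (y|z)_t) - δ`. -/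
def IsDeltaHyp {n : ℕ} (C : Set (Euc n)) (δ : ℝ) : Prop :=
  ∀ x ∈ C, ∀ y ∈ C, ∀ z ∈ C, ∀ t ∈ C,
    gromovProd (hDist C) x y t ≥
      min (gromovProd (hDist C) x z t) (gromovProd (hDist C) y z t) - δ

/-- The metric ball `B_R(x)` of the Hilbert metric of `C`. -/
def hBall {n : ℕ} (C : Set (Euc n)) (x : Euc n) (R : ℝ) : Set (Euc n) :=
  {y ∈ C | hDist C x y < R}

/-- The image of `C` under the homothety of center `P₀` and ratio `r`. -/
def homoth {n : ℕ} (P₀ : Euc n) (r : ℝ) (C : Set (Euc n)) : Set (Euc n) :=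
  (fun x => P₀ + r • (x - P₀)) '' C

/-- Diameter of a set with respect to a distance function `d`. -/
def ediamD {α : Type*} (d : α → α → ℝ) (S : Set α) : ℝ≥0∞ :=
  ⨆ x ∈ S, ⨆ y ∈ S, ENNReal.ofReal (d x y)

/-- The `k`-dimensional Hausdorff measure of `S` with respect to the distance
function `d`. -/
def hausD {α : Type*} (k : ℝ) (d : α → α → ℝ) (S : Set α) : ℝ≥0∞ :=
  ⨆ (ε : ℝ≥0∞) (_ : 0 < ε),
    ⨅ (U : ℕ → Set α) (_ : S ⊆ ⋃ i, U i) (_ : ∀ i, ediamD d (U i) ≤ ε),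
      ∑' i, ediamD d (U i) ^ k

/-- The frontier of `U` is a rectifiable closed curve (for the Hilbert metric of `C`):
it is the image of a closed continuous curve and has finite one-dimensional Hausdorff
measure. -/
def RectCurveBoundary (C U : Set (Euc 2)) : Prop :=
  ∃ c : ℝ → Euc 2, ContinuousOn c (Icc 0 1) ∧ c '' Icc (0 : ℝ) 1 = frontier U ∧
    c 0 = c 1 ∧ hausD 1 (hDist C) (frontier U) < ⊤

/-- The Cheeger constant `I_∞^C(Ω)` in dimension `2`: infimum of
`ν_C(∂U)/μ_C(U)` over open sets `U` with closure contained in `Ω` whose boundary is a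
rectifiable curve, `ν_C` being the `1`-dimensional Hausdorff measure of `(C, d_C)`. -/
def cheeger2D (C Ω : Set (Euc 2)) : ℝ :=
  sInf {r : ℝ | ∃ U : Set (Euc 2), IsOpen U ∧ U.Nonempty ∧ closure U ⊆ Ω ∧
    RectCurveBoundary C U ∧
    r = (hausD 1 (hDist C) (frontier U)).toReal / (hMeasure C U).toReal}

/-- The Cheeger constant `I_∞(C)` of a planar Hilbert geometry. -/
def cheeger2 (C : Set (Euc 2)) : ℝ := cheeger2D C C

/-- `S` is a `C¹` hypersurface: near each of its points it is the zero set of a `C¹`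
function with nonvanishing differential. -/
def IsC1Hypersurface {n : ℕ} (S : Set (Euc n)) : Prop :=
  ∀ x ∈ S, ∃ (f : Euc n → ℝ) (U : Set (Euc n)), U ∈ nhds x ∧ ContDiffOn ℝ 1 f U ∧
    (∀ y ∈ U, fderiv ℝ f y ≠ 0) ∧ S ∩ U = {y ∈ U | f y = 0}

/-- The Cheeger constant `I_∞^C(Ω)` in dimension `n`: infimum of `ν_C(∂U)/μ_C(U)` over
open sets `U` with closure contained in `Ω` whose boundary is a `C¹` hypersurface,
`ν_C` being the `(n-1)`-dimensional Hausdorff measure of `(C, d_C)`. -/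
def cheegerND {n : ℕ} (C Ω : Set (Euc n)) : ℝ :=
  sInf {r : ℝ | ∃ U : Set (Euc n), IsOpen U ∧ U.Nonempty ∧ closure U ⊆ Ω ∧
    IsC1Hypersurface (frontier U) ∧
    r = (hausD ((n : ℝ) - 1) (hDist C) (frontier U)).toReal / (hMeasure C U).toReal}

/-- The boundary of the convex set `C` is of class `C¹`: through each boundary point
passes a unique supporting hyperplane. -/
def HasC1Boundary {n : ℕ} (C : Set (Euc n)) : Prop :=
  ∀ x ∈ frontier C, ∃! l : Euc n →L[ℝ] ℝ, ‖l‖ = 1 ∧ ∀ y ∈ C, l y ≤ l x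

/-- The convex set `C` is strictly convex: the open segment joining two distinct
boundary points is contained in `C`. -/
def IsStrictlyConvexSet {n : ℕ} (C : Set (Euc n)) : Prop :=
  ∀ x ∈ frontier C, ∀ y ∈ frontier C, x ≠ y → openSegment ℝ x y ⊆ C

end

theorem seg_mem {C : Set (Euc 2)} (hconv : Convex ℝ C) (hopen : IsOpen C) {X o : Euc 2}
    (hX : X ∈ closure C) (ho : o ∈ C) {s : ℝ} (hs : 0 < s) (hs1 : s ≤ 1) :
    X + s • (o - X) ∈ C := by
  rcases hs1.eq_or_lt with h | h
  · subst h; simpa using ho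
  have := hconv.openSegment_closure_interior_subset_interior hX (by rwa [hopen.interior_eq])
  rw [hopen.interior_eq] at this
  apply this
  refine ⟨1 - s, s, by linarith, hs, by ring, ?_⟩
  module

theorem lp_bdd {C : Set (Euc 2)} (hbdd : Bornology.IsBounded C) (p v : Euc 2) (hv : v ≠ 0) :
    ∃ B : ℝ, ∀ t ∈ lineParams C p v, |t| ≤ B := by
  obtain ⟨R, hR⟩ := hbdd.exists_norm_le
  refine ⟨(R + ‖p‖) / ‖v‖, fun t ht => ?_⟩
  have hv' : 0 < ‖v‖ := norm_pos_iff.2 hv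
  rw [le_div_iff₀ hv']
  have h1 := hR _ ht
  have h2 : ‖t • v‖ ≤ ‖p + t • v‖ + ‖p‖ := by
    have := norm_sub_le (p + t • v) p
    simpa using this
  rw [norm_smul, Real.norm_eq_abs] at h2
  linarith

theorem hd_exists {C : Set (Euc 2)} (hconv : Convex ℝ C) (hopen : IsOpen C)
    (hbdd : Bornology.IsBounded C) {p q : Euc 2} (hp : p ∈ C) (hq : q ∈ C) (hpq : p ≠ q) :
    ∃ T0 T1 : ℝ, T0 < 0 ∧ 1 < T1 ∧ p + T0 • (q - p) ∈ closure C ∧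
      p + T1 • (q - p) ∈ closure C ∧
      (∀ t : ℝ, p + t • (q - p) ∈ closure C → T0 ≤ t ∧ t ≤ T1) ∧
      hDist C p q = 1 / 2 * Real.log (((1 - T0) * T1) / ((-T0) * (T1 - 1))) := by
  have hv : q - p ≠ 0 := sub_ne_zero.2 (Ne.symm hpq)
  have hcont : Continuous (fun t : ℝ => p + t • (q - p)) := by fun_prop
  have hLo : IsOpen (lineParams C p (q - p)) := hopen.preimage hcont
  obtain ⟨B, hB⟩ := lp_bdd hbdd p (q - p) hv
  have h0 : (0 : ℝ) ∈ lineParams C p (q - p) := by simpa [lineParams] using hp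
  have h1 : (1 : ℝ) ∈ lineParams C p (q - p) := by simpa [lineParams] using hq
  have hba : BddAbove (lineParams C p (q - p)) := ⟨B, fun t ht => (abs_le.1 (hB t ht)).2⟩
  have hbb : BddBelow (lineParams C p (q - p)) := ⟨-B, fun t ht => (abs_le.1 (hB t ht)).1⟩
  have hT1 : 1 < sSup (lineParams C p (q - p)) := by
    obtain ⟨ε, hε, hb⟩ := Metric.isOpen_iff.1 hLo 1 h1
    have : 1 + ε / 2 ∈ lineParams C p (q - p) := hb (by
      rw [Metric.mem_ball, Real.dist_eq, abs_lt]; constructor <;> linarith)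
    have := le_csSup hba this
    linarith
  have hT0 : sInf (lineParams C p (q - p)) < 0 := by
    obtain ⟨ε, hε, hb⟩ := Metric.isOpen_iff.1 hLo 0 h0
    have : - (ε / 2) ∈ lineParams C p (q - p) := hb (by
      rw [Metric.mem_ball, Real.dist_eq, abs_lt]; constructor <;> linarith)
    have := csInf_le hbb this
    linarith
  refine ⟨sInf (lineParams C p (q - p)), sSup (lineParams C p (q - p)), hT0, hT1, ?_, ?_, ?_, ?_⟩
  · exact map_mem_closure (f := fun t : ℝ => p + t • (q - p)) hcont (csInf_mem_closure ⟨0, h0⟩ hbb) (fun t ht => ht)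
  · exact map_mem_closure (f := fun t : ℝ => p + t • (q - p)) hcont (csSup_mem_closure ⟨0, h0⟩ hba) (fun t ht => ht)
  · intro t ht
    have key : ∀ r : ℝ, 0 ≤ r → r < 1 → r * t ∈ lineParams C p (q - p) := by
      intro r hr0 hr1
      have := seg_mem hconv hopen ht hp (s := 1 - r) (by linarith) (by linarith)
      have e : p + (r * t) • (q - p) = p + t • (q - p) + (1 - r) • (p - (p + t • (q - p))) := by
        module
      change p + (r * t) • (q - p) ∈ C
      rw [e]; exact this
    constructor
    · by_contra! h
      have ht0 : t < 0 := h.trans hT0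
      have := csInf_le hbb (key (((t + sInf (lineParams C p (q - p))) / 2) / t)
        (div_nonneg_of_nonpos (by linarith) ht0.le) (by rw [div_lt_one_of_neg ht0]; linarith))
      rw [div_mul_cancel₀ _ ht0.ne] at this
      linarith
    · by_contra! h
      have ht0 : 0 < t := by linarith
      have := le_csSup hba (key (((t + sSup (lineParams C p (q - p))) / 2) / t)
        (div_nonneg (by linarith) ht0.le) (by rw [div_lt_one ht0]; linarith))
      rw [div_mul_cancel₀ _ ht0.ne'] at this
      linarith
  · rw [hDist, if_neg hpq]

theorem hd_up {C : Set (Euc 2)} (hconv : Convex ℝ C) (hopen : IsOpen C)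
    (hbdd : Bornology.IsBounded C) {p q : Euc 2} (hp : p ∈ C) (hq : q ∈ C) (hpq : p ≠ q)
    {t0 t1 : ℝ} (ht0 : t0 < 0) (ht1 : 1 < t1) (h0 : p + t0 • (q - p) ∈ closure C)
    (h1 : p + t1 • (q - p) ∈ closure C) :
    hDist C p q ≤ 1 / 2 * Real.log (((1 - t0) * t1) / ((-t0) * (t1 - 1))) := by
  obtain ⟨T0, T1, hT0, hT1, -, -, hT, hd⟩ := hd_exists hconv hopen hbdd hp hq hpq
  rw [hd]
  have a0 := (hT _ h0).1
  have a1 := (hT _ h1).2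
  have b1 : 0 < (1 - T0) * T1 := by apply mul_pos <;> linarith
  have b2 : 0 < (-T0) * (T1 - 1) := by apply mul_pos <;> linarith
  have b3 : 0 < (-t0) * (t1 - 1) := by apply mul_pos <;> linarith
  have : (1 - T0) * T1 / ((-T0) * (T1 - 1)) ≤ (1 - t0) * t1 / ((-t0) * (t1 - 1)) := by
    rw [mul_div_mul_comm, mul_div_mul_comm]
    apply mul_le_mul
    · rw [div_le_div_iff₀ (by linarith) (by linarith)]; nlinarith
    · rw [div_le_div_iff₀ (by linarith) (by linarith)]; nlinarith
    · apply div_nonneg <;> linarith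
    · apply div_nonneg <;> linarith
  have := Real.log_le_log (div_pos b1 b2) this
  linarith

theorem hd_low {C : Set (Euc 2)} (hconv : Convex ℝ C) (hopen : IsOpen C)
    (hbdd : Bornology.IsBounded C) {p q : Euc 2} (hp : p ∈ C) (hq : q ∈ C) (hpq : p ≠ q)
    (F G : Euc 2 →L[ℝ] ℝ) (c d : ℝ) (hF : ∀ y ∈ C, 0 < c + F y) (hG : ∀ y ∈ C, 0 < d + G y) :
    1 / 2 * Real.log (((c + F p) * (d + G q)) / ((c + F q) * (d + G p))) ≤ hDist C p q := by
  obtain ⟨T0, T1, hT0, hT1, h0, h1, hT, hd⟩ := hd_exists hconv hopen hbdd hp hq hpq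
  rw [hd]
  have cl : ∀ (F : Euc 2 →L[ℝ] ℝ) (c : ℝ), (∀ y ∈ C, 0 < c + F y) →
      ∀ y ∈ closure C, 0 ≤ c + F y := by
    intro F c hF y hy
    have hcl : IsClosed {y : Euc 2 | 0 ≤ c + F y} := isClosed_le (by fun_prop) (by fun_prop)
    exact closure_minimal (fun y hy => (hF y hy).le) hcl hy
  have e0 := cl G d hG _ h0
  have e1 := cl F c hF _ h1
  simp only [map_add, map_smul, map_sub, smul_eq_mul] at e0 e1
  have fp := hF p hp
  have fq := hF q hq
  have gp := hG p hp
  have gq := hG q hq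
  have b1 : 0 < (c + F p) * (d + G q) := by positivity
  have b3 : 0 < (c + F q) * (d + G p) := by positivity
  have : ((c + F p) * (d + G q)) / ((c + F q) * (d + G p))
      ≤ (1 - T0) * T1 / ((-T0) * (T1 - 1)) := by
    rw [mul_div_mul_comm, mul_comm (1 - T0), mul_comm (-T0), mul_div_mul_comm]
    apply mul_le_mul
    · rw [div_le_div_iff₀ (by linarith) (by linarith)]; nlinarith
    · rw [div_le_div_iff₀ (by linarith) (by linarith)]; nlinarith
    · apply div_nonneg <;> linarith
    · apply div_nonneg <;> linarith
  have := Real.log_le_log (div_pos b1 b3) this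
  linarith

theorem hd_o_up {C : Set (Euc 2)} (hconv : Convex ℝ C) (hopen : IsOpen C)
    (hbdd : Bornology.IsBounded C) {o : Euc 2} (ho : o ∈ C) :
    ∃ c : ℝ, 0 < c ∧ ∀ X ∈ closure C, X ≠ o → ∀ s : ℝ, 0 < s → s < 1 →
      hDist C (X + s • (o - X)) o ≤ 1 / 2 * Real.log (c / s) := by
  obtain ⟨R, hR⟩ := hbdd.closure.exists_norm_le
  obtain ⟨ε, hε, hb⟩ := Metric.isOpen_iff.1 hopen o ho
  have hRo := hR o (subset_closure ho)
  have hR0 : 0 ≤ R := (norm_nonneg _).trans hRo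
  set k : ℝ := ε / (2 * R + 1) with hk
  have hk0 : 0 < k := by positivity
  refine ⟨(1 + k) / k, by positivity, fun X hX hXo s hs hs1 => ?_⟩
  have hok : o + k • (o - X) ∈ C := by
    apply hb
    rw [Metric.mem_ball, dist_eq_norm, add_sub_cancel_left, norm_smul, Real.norm_eq_abs,
      abs_of_pos hk0]
    have h1 : ‖o - X‖ ≤ 2 * R := by
      have := norm_sub_le o X
      have := hR X hX
      linarith
    calc k * ‖o - X‖ ≤ k * (2 * R) := by gcongr
      _ < k * (2 * R + 1) := by nlinarith
      _ = ε := by rw [hk]; field_simp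
  have hpC := seg_mem hconv hopen hX ho hs hs1.le
  have hs1' : 0 < 1 - s := by linarith
  have hne : X + s • (o - X) ≠ o := by
    intro h
    have : (1 - s) • (X - o) = 0 := by
      have h2 : X + s • (o - X) - o = 0 := sub_eq_zero.2 h
      rw [← h2]; module
    rcases smul_eq_zero.1 this with h | h
    · linarith
    · exact hXo (sub_eq_zero.1 h)
  have := hd_up hconv hopen hbdd hpC ho hne (t0 := - (s / (1 - s))) (t1 := (1 - s + k) / (1 - s))
    (by have : 0 < s / (1 - s) := by positivity
        linarith) (by rw [one_lt_div hs1']; linarith) ?_ ?_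
  · refine this.trans ?_
    have e : (1 - -(s / (1 - s))) * ((1 - s + k) / (1 - s)) /
        (- -(s / (1 - s)) * ((1 - s + k) / (1 - s) - 1)) = (1 - s + k) / (k * s) := by
      have e1 : 1 - -(s / (1 - s)) = 1 / (1 - s) := by field_simp; ring
      have e2 : (1 - s + k) / (1 - s) - 1 = k / (1 - s) := by field_simp; ring
      rw [e1, e2]
      clear_value k
      field_simp
    rw [e]
    have : Real.log ((1 - s + k) / (k * s)) ≤ Real.log ((1 + k) / k / s) := by
      apply Real.log_le_log (by positivity)
      rw [div_div]
      gcongr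
      linarith
    linarith
  · convert hX using 1
    have : o - (X + s • (o - X)) = (1 - s) • (o - X) := by module
    rw [this, smul_smul, neg_mul, div_mul_cancel₀ _ hs1'.ne']
    module
  · convert subset_closure hok using 1
    have : o - (X + s • (o - X)) = (1 - s) • (o - X) := by module
    rw [this, smul_smul, div_mul_cancel₀ _ hs1'.ne']
    module

theorem four_pt {C : Set (Euc 2)} {δ : ℝ} (h : IsDeltaHyp C δ) {x y z o : Euc 2}
    (hx : x ∈ C) (hy : y ∈ C) (hz : z ∈ C) (ho : o ∈ C) :
    hDist C x y + hDist C z o ≤ hDist C x z + hDist C y o + 2 * δ ∨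
    hDist C x y + hDist C z o ≤ hDist C y z + hDist C x o + 2 * δ := by
  have := h x hx y hy z hz o ho
  simp only [gromovProd, ge_iff_le] at this
  rw [sub_le_iff_le_add, min_le_iff] at this
  rcases this with h | h
  · left; linarith
  · right; linarith


theorem hd_col {C : Set (Euc 2)} (hconv : Convex ℝ C) (hopen : IsOpen C)
    (hbdd : Bornology.IsBounded C) {x y z : Euc 2} (hx : x ∈ C) (hy : y ∈ C) (hxy : x ≠ y)
    {φ ε : ℝ} (h0 : 0 < φ) (h1 : φ < 1) (hε : 0 < ε) (hz : z = x + φ • (y - x))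
    (hu : x + (1 + ε) • (y - x) ∉ closure C) (hl : x + (-ε) • (y - x) ∉ closure C) :
    1 / 2 * Real.log ((1 - φ) / ε) ≤ hDist C x y - hDist C x z ∧
    1 / 2 * Real.log (φ / ε) ≤ hDist C x y - hDist C y z := by
  have hzC : z ∈ C := by
    rw [hz]; exact seg_mem hconv hopen (subset_closure hx) hy h0 h1.le
  obtain ⟨T0, T1, hT0, hT1, m0, m1, hT, hd⟩ := hd_exists hconv hopen hbdd hx hy hxy
  have hcc : Convex ℝ (closure C) := hconv.closure
  have hpar : ∀ t : ℝ, T0 ≤ t → t ≤ T1 → x + t • (y - x) ∈ closure C := by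
    intro t ht0 ht1
    have hd' : 0 < T1 - T0 := by linarith
    have := hcc m0 m1 (a := (T1 - t) / (T1 - T0)) (b := (t - T0) / (T1 - T0))
      (div_nonneg (by linarith) hd'.le) (div_nonneg (by linarith) hd'.le) (by field_simp; ring)
    convert this using 1
    have e : t = (T1 - t) / (T1 - T0) * T0 + (t - T0) / (T1 - T0) * T1 := by field_simp; ring
    have e2 : (T1 - t) / (T1 - T0) = 1 - (t - T0) / (T1 - T0) := by field_simp; ring
    rw [e2] at e ⊢
    generalize (t - T0) / (T1 - T0) = r at *
    rw [e]
    module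
  have g1 : T1 < 1 + ε := by
    by_contra! h
    exact hu (hpar _ (by linarith) h)
  have g0 : -ε < T0 := by
    by_contra! h
    exact hl (hpar _ h (by linarith))
  have hv : y - x ≠ 0 := sub_ne_zero.2 (Ne.symm hxy)
  have hxz : x ≠ z := by
    intro h
    rw [hz] at h
    have : φ • (y - x) = 0 := by simpa using h
    rcases smul_eq_zero.1 this with h | h
    · linarith
    · exact hv h
  have hyz : y ≠ z := by
    intro h
    rw [hz] at h
    have : (1 - φ) • (y - x) = 0 := by
      have h2 := sub_eq_zero.2 h
      rw [← h2]; module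
    rcases smul_eq_zero.1 this with h | h
    · linarith
    · exact hv h
  have p1 : 0 < T1 - 1 := by linarith
  have p2 : 0 < -T0 := by linarith
  have p3 : 0 < 1 - φ := by linarith
  have p4 : 0 < T1 - φ := by linarith
  have p5 : 0 < φ - T0 := by linarith
  have p6 : 0 < 1 - T0 := by linarith
  have p7 : 0 < T1 := by linarith
  constructor
  · have up := hd_up hconv hopen hbdd hx hzC hxz (t0 := T0 / φ) (t1 := T1 / φ)
      (div_neg_of_neg_of_pos hT0 h0) (by rw [one_lt_div h0]; linarith)
      (by convert m0 using 1
          have : z - x = φ • (y - x) := by rw [hz]; module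
          rw [this, smul_smul, div_mul_cancel₀ _ h0.ne'])
      (by convert m1 using 1
          have : z - x = φ • (y - x) := by rw [hz]; module
          rw [this, smul_smul, div_mul_cancel₀ _ h0.ne'])
    have e : (1 - T0 / φ) * (T1 / φ) / (-(T0 / φ) * (T1 / φ - 1))
        = ((φ - T0) * T1) / (-T0 * (T1 - φ)) := by
      have e1 : 1 - T0 / φ = (φ - T0) / φ := by field_simp
      have e2 : T1 / φ - 1 = (T1 - φ) / φ := by field_simp
      have e3 : -(T0 / φ) = (-T0) / φ := by ring
      rw [e1, e2, e3]
      generalize -T0 = A at *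
      field_simp
    rw [e] at up
    have key : (1 - φ) / ε * (((φ - T0) * T1) / (-T0 * (T1 - φ)))
        ≤ (1 - T0) * T1 / (-T0 * (T1 - 1)) := by
      have a1 : (1 - φ) / ε ≤ (1 - φ) / (T1 - 1) := by gcongr; linarith
      calc _ ≤ (1 - φ) / (T1 - 1) * (((φ - T0) * T1) / (-T0 * (T1 - φ))) := by gcongr
        _ ≤ _ := by
          rw [div_mul_div_comm, div_le_div_iff₀ (by positivity) (by positivity)]
          have : (1 - φ) * (φ - T0) ≤ (1 - T0) * (T1 - φ) := by
            rw [mul_comm (1 - φ)]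
            apply mul_le_mul <;> linarith
          have h3 : 0 ≤ T1 * (-T0) * (T1 - 1) := by positivity
          nlinarith [mul_le_mul_of_nonneg_right this h3]
    have := Real.log_le_log (by positivity) key
    rw [Real.log_mul (by positivity) (by positivity)] at this
    rw [hd]
    linarith
  · have ez : z - y = (-(1 - φ)) • (y - x) := by rw [hz]; module
    have up := hd_up hconv hopen hbdd hy hzC hyz (t0 := -((T1 - 1) / (1 - φ)))
      (t1 := (1 - T0) / (1 - φ))
      (by have : 0 < (T1 - 1) / (1 - φ) := by positivity
          linarith) (by rw [one_lt_div p3]; linarith)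
      (by convert m1 using 1
          rw [ez, smul_smul, neg_mul_neg, div_mul_cancel₀ _ p3.ne']
          module)
      (by convert m0 using 1
          rw [ez, smul_smul, mul_neg, div_mul_cancel₀ _ p3.ne']
          module)
    have e : (1 - -((T1 - 1) / (1 - φ))) * ((1 - T0) / (1 - φ)) /
        (- -((T1 - 1) / (1 - φ)) * ((1 - T0) / (1 - φ) - 1))
        = ((T1 - φ) * (1 - T0)) / ((T1 - 1) * (φ - T0)) := by
      have e1 : 1 - -((T1 - 1) / (1 - φ)) = (T1 - φ) / (1 - φ) := by field_simp; ring
      have e2 : (1 - T0) / (1 - φ) - 1 = (φ - T0) / (1 - φ) := by field_simp; ring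
      rw [e1, e2, neg_neg]
      field_simp
    rw [e] at up
    have key : φ / ε * (((T1 - φ) * (1 - T0)) / ((T1 - 1) * (φ - T0)))
        ≤ (1 - T0) * T1 / (-T0 * (T1 - 1)) := by
      have a1 : φ / ε ≤ φ / (-T0) := by gcongr; linarith
      calc _ ≤ φ / (-T0) * (((T1 - φ) * (1 - T0)) / ((T1 - 1) * (φ - T0))) := by gcongr
        _ ≤ _ := by
          rw [div_mul_div_comm, div_le_div_iff₀ (by positivity) (by positivity)]
          have : φ * (T1 - φ) ≤ (φ - T0) * T1 := by
            apply mul_le_mul <;> linarith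
          have h3 : 0 ≤ (1 - T0) * (-T0) * (T1 - 1) := by positivity
          nlinarith [mul_le_mul_of_nonneg_right this h3]
    have := Real.log_le_log (by positivity) key
    rw [Real.log_mul (by positivity) (by positivity)] at this
    rw [hd]
    linarith

theorem flat_core {C : Set (Euc 2)} (hconv : Convex ℝ C) (hopen : IsOpen C)
    (hbdd : Bornology.IsBounded C) {o : Euc 2} (ho : o ∈ C) {δ : ℝ}
    (hhyp : IsDeltaHyp C δ) {a b : Euc 2} (ha : a ∈ closure C) (hb : b ∈ closure C)
    {φ : ℝ} (h0 : 0 < φ) (h1 : φ < 1) (hab : a ≠ b)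
    (hm : a + φ • (b - a) ∉ C) (hbm : ∀ ε : ℝ, 0 < ε → b + ε • (b - a) ∉ closure C)
    (ham : ∀ ε : ℝ, 0 < ε → a - ε • (b - a) ∉ closure C) : False := by
  obtain ⟨c, hc, hup⟩ := hd_o_up hconv hopen hbdd ho
  obtain ⟨f, hf⟩ := geometric_hahn_banach_open_point hconv hopen hm
  have hao : a ≠ o := by
    rintro rfl
    apply hm
    have := seg_mem hconv hopen hb ho (s := 1 - φ) (by linarith) (by linarith)
    convert this using 1
    module
  have hbo : b ≠ o := by
    rintro rfl
    exact hm (seg_mem hconv hopen ha ho h0 h1.le)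
  set μ : ℝ := min φ (1 - φ) with hμ
  have hμ0 : 0 < μ := lt_min h0 (by linarith)
  set ε : ℝ := μ / (2 * (c * Real.exp (4 * δ))) with hεd
  have hε : 0 < ε := by positivity
  have hbig : Real.log c + 4 * δ < Real.log (μ / ε) := by
    have : μ / ε = 2 * (c * Real.exp (4 * δ)) := by rw [hεd]; field_simp
    rw [this, Real.log_mul (by norm_num) (by positivity), Real.log_mul hc.ne' (by positivity),
      Real.log_exp]
    have := Real.log_pos (one_lt_two)
    linarith
  have ev1 : ∀ᶠ s : ℝ in nhds 0, (a + s • (o - a)) +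
      (1 + ε) • ((b + s • (o - b)) - (a + s • (o - a))) ∈ (closure C)ᶜ := by
    have hcont : Continuous (fun s : ℝ => (a + s • (o - a)) +
      (1 + ε) • ((b + s • (o - b)) - (a + s • (o - a)))) := by fun_prop
    apply hcont.continuousAt.eventually_mem
    apply isClosed_closure.isOpen_compl.mem_nhds
    rw [mem_compl_iff]
    convert hbm ε hε using 2
    module
  have ev2 : ∀ᶠ s : ℝ in nhds 0, (a + s • (o - a)) +
      (-ε) • ((b + s • (o - b)) - (a + s • (o - a))) ∈ (closure C)ᶜ := by
    have hcont : Continuous (fun s : ℝ => (a + s • (o - a)) +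
      (-ε) • ((b + s • (o - b)) - (a + s • (o - a)))) := by fun_prop
    apply hcont.continuousAt.eventually_mem
    apply isClosed_closure.isOpen_compl.mem_nhds
    rw [mem_compl_iff]
    convert ham ε hε using 2
    module
  have ev3 : ∀ᶠ s : ℝ in nhds 0, s < 1 := eventually_lt_nhds one_pos
  have ev := (ev1.and (ev2.and ev3)).filter_mono (nhdsWithin_le_nhds (s := Ioi 0))
  obtain ⟨s, ⟨hs1, hs2, hs3⟩, hs⟩ := (ev.and self_mem_nhdsWithin).exists
  have hs : 0 < s := hs
  have hxC := seg_mem hconv hopen ha ho hs hs3.le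
  have hyC := seg_mem hconv hopen hb ho hs hs3.le
  set m := a + φ • (b - a) with hmd
  have hmcl : m ∈ closure C := by
    have := hconv.closure ha hb (a := 1 - φ) (b := φ) (by linarith) h0.le (by ring)
    convert this using 1
    rw [hmd]; module
  have hzC := seg_mem hconv hopen hmcl ho hs hs3.le
  have hxy : a + s • (o - a) ≠ b + s • (o - b) := by
    intro h
    have : (1 - s) • (a - b) = 0 := by
      rw [← sub_eq_zero.2 h]; module
    rcases smul_eq_zero.1 this with h | h
    · linarith
    · exact hab (sub_eq_zero.1 h)
  have hcol := hd_col hconv hopen hbdd hxC hyC hxy h0 h1 hε (z := m + s • (o - m))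
    (by rw [hmd]; module) hs1 hs2
  have hzo : m + s • (o - m) ≠ o := by
    intro h
    have : (1 - s) • (m - o) = 0 := by
      rw [← sub_eq_zero.2 h]; module
    rcases smul_eq_zero.1 this with h | h
    · linarith
    · exact hm (by rw [sub_eq_zero.1 h]; exact ho)
  have hlow := hd_low hconv hopen hbdd hzC ho hzo 0 (-f) 1 (f m) (by simp)
    (fun y hy => by have := hf y hy; simpa using this)
  have hfo := hf o ho
  have e : (1 + (0 : Euc 2 →L[ℝ] ℝ) (m + s • (o - m))) * (f m + (-f) o) /
      ((1 + (0 : Euc 2 →L[ℝ] ℝ) o) * (f m + (-f) (m + s • (o - m)))) = 1 / s := by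
    have g1 : (-f) (m + s • (o - m)) = -(f m + s * (f o - f m)) := by simp
    have g2 : (-f) o = - f o := rfl
    have g3 : ∀ v, (0 : Euc 2 →L[ℝ] ℝ) v = 0 := fun v => rfl
    rw [g1, g2, g3, g3]
    have h5 : f m + -(f m + s * (f o - f m)) = s * (f m - f o) := by ring
    have h6 : 0 < f m - f o := by linarith
    rw [h5, ← sub_eq_add_neg]
    field_simp
    try ring
  rw [e] at hlow
  have ux := hup a ha hao s hs hs3
  have uy := hup b hb hbo s hs hs3
  have el : Real.log (c / s) = Real.log c + Real.log (1 / s) := by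
    rw [← Real.log_mul hc.ne' (by positivity)]; ring_nf
  rw [el] at ux uy
  have k1 : Real.log (μ / ε) ≤ Real.log (φ / ε) := by
    apply Real.log_le_log (by positivity)
    gcongr
    exact min_le_left _ _
  have k2 : Real.log (μ / ε) ≤ Real.log ((1 - φ) / ε) := by
    apply Real.log_le_log (by positivity)
    gcongr
    exact min_le_right _ _
  rcases four_pt hhyp hxC hyC hzC ho with h | h
  · linarith [hcol.1]
  · linarith [hcol.2]

theorem strict_main {C : Set (Euc 2)} (hconv : Convex ℝ C) (hopen : IsOpen C)
    (hbdd : Bornology.IsBounded C) (hne : C.Nonempty) {δ : ℝ}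
    (hhyp : IsDeltaHyp C δ) : IsStrictlyConvexSet C := by
  obtain ⟨o, ho⟩ := hne
  intro x hx y hy hxy w hw
  by_contra hwC
  rw [openSegment_eq_image] at hw
  obtain ⟨θ, ⟨hθ0, hθ1⟩, rfl⟩ := hw
  have hv : y - x ≠ 0 := sub_ne_zero.2 (Ne.symm hxy)
  have hcont : Continuous (fun t : ℝ => x + t • (y - x)) := by fun_prop
  have hUc : IsClosed (lineParams (closure C) x (y - x)) := isClosed_closure.preimage hcont
  obtain ⟨B, hB⟩ := lp_bdd hbdd.closure x (y - x) hv
  have h0 : (0 : ℝ) ∈ lineParams (closure C) x (y - x) := by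
    simpa [lineParams] using frontier_subset_closure hx
  have h1 : (1 : ℝ) ∈ lineParams (closure C) x (y - x) := by
    simpa [lineParams] using frontier_subset_closure hy
  have hba : BddAbove (lineParams (closure C) x (y - x)) :=
    ⟨B, fun t ht => (abs_le.1 (hB t ht)).2⟩
  have hbb : BddBelow (lineParams (closure C) x (y - x)) :=
    ⟨-B, fun t ht => (abs_le.1 (hB t ht)).1⟩
  have m1 := hUc.csSup_mem ⟨0, h0⟩ hba
  have m0 := hUc.csInf_mem ⟨0, h0⟩ hbb
  have l1 : ∀ t, x + t • (y - x) ∈ closure C → t ≤ sSup (lineParams (closure C) x (y - x)) :=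
    fun t ht => le_csSup hba ht
  have l0 : ∀ t, x + t • (y - x) ∈ closure C → sInf (lineParams (closure C) x (y - x)) ≤ t :=
    fun t ht => csInf_le hbb ht
  have k1 := le_csSup hba h1
  have k0 := csInf_le hbb h0
  generalize sSup (lineParams (closure C) x (y - x)) = t1 at *
  generalize sInf (lineParams (closure C) x (y - x)) = t0 at *
  have hd : 0 < t1 - t0 := by linarith
  refine flat_core hconv hopen hbdd ho hhyp (a := x + t0 • (y - x)) (b := x + t1 • (y - x))
    m0 m1 (φ := (θ - t0) / (t1 - t0)) (div_pos (by linarith) hd)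
    (by rw [div_lt_one hd]; linarith) ?_ ?_ ?_ ?_
  · intro h
    have : (t1 - t0) • (y - x) = 0 := by
      rw [← sub_eq_zero.2 h.symm]; module
    rcases smul_eq_zero.1 this with h | h
    · linarith
    · exact hv h
  · convert hwC using 2
    have : x + t1 • (y - x) - (x + t0 • (y - x)) = (t1 - t0) • (y - x) := by module
    rw [this, smul_smul, div_mul_cancel₀ _ hd.ne']
    module
  · intro ε hε h
    have := l1 (t1 + ε * (t1 - t0)) (by convert h using 1; module)
    nlinarith [mul_pos hε hd]
  · intro ε hε h
    have := l0 (t0 - ε * (t1 - t0)) (by convert h using 1; module)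
    nlinarith [mul_pos hε hd]


theorem corner_core {C : Set (Euc 2)} (hconv : Convex ℝ C) (hopen : IsOpen C)
    (hbdd : Bornology.IsBounded C) {δ : ℝ} (hhyp : IsDeltaHyp C δ) {x0 E1 E2 : Euc 2}
    (F G : Euc 2 →L[ℝ] ℝ) (F1 : F E1 = 1) (F2 : F E2 = 0) (G1 : G E1 = 0) (G2 : G E2 = 1)
    (hx0 : x0 ∈ closure C) (ho : x0 + (E1 + E2) ∈ C)
    (hF : ∀ y ∈ C, 0 < -F x0 + F y) (hG : ∀ y ∈ C, 0 < -G x0 + G y)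
    (hT : ∀ p q : ℝ, 0 < p → 0 < q → ∃ r : ℝ, 0 < r ∧ x0 + r • (p • E1 + q • E2) ∈ C) :
    False := by
  obtain ⟨c, hc, hup⟩ := hd_o_up hconv hopen hbdd ho
  set K : ℝ := 2 + 8 * c * Real.exp (4 * δ) with hK
  have hK2 : 2 < K := by
    have : 0 < 8 * c * Real.exp (4 * δ) := by positivity
    linarith
  have hKlog : Real.log 4 + Real.log (2 * c) + 4 * δ < Real.log K := by
    have : Real.log 4 + Real.log (2 * c) + 4 * δ = Real.log (8 * c * Real.exp (4 * δ)) := by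
      rw [Real.log_mul (x := 8 * c) (by positivity) (by positivity), Real.log_exp,
        ← Real.log_mul (by norm_num) (by positivity)]
      ring_nf
    rw [this]
    exact Real.log_lt_log (by positivity) (by linarith)
  clear_value K
  have hbox : ∃ s : ℝ, 0 < s ∧ s ≤ 1 / 2 ∧ ∀ p q : ℝ, 1 / 2 ≤ p → p ≤ 2 * K → 1 / 2 ≤ q →
      q ≤ 2 * K → x0 + ((s * p) • E1 + (s * q) • E2) ∈ C := by
    obtain ⟨r1, hr1, m1⟩ := hT (1 / 2) (1 / 2) (by norm_num) (by norm_num)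
    obtain ⟨r2, hr2, m2⟩ := hT (1 / 2) (2 * K) (by norm_num) (by linarith)
    obtain ⟨r3, hr3, m3⟩ := hT (2 * K) (1 / 2) (by linarith) (by norm_num)
    obtain ⟨r4, hr4, m4⟩ := hT (2 * K) (2 * K) (by linarith) (by linarith)
    obtain ⟨s, hs, hsle⟩ : ∃ s : ℝ, 0 < s ∧ (s ≤ 1 / 2 ∧ s ≤ r1 ∧ s ≤ r2 ∧ s ≤ r3 ∧ s ≤ r4) := by
      refine ⟨min (1 / 2) (min r1 (min r2 (min r3 r4))), by positivity, ?_⟩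
      simp
    obtain ⟨h5, h1, h2, h3, h4⟩ := hsle
    have shr : ∀ (r : ℝ) (v : Euc 2), 0 < r → s ≤ r → x0 + r • v ∈ C → x0 + s • v ∈ C := by
      intro r v hr hsr hv
      have := seg_mem hconv hopen hx0 hv (s := s / r) (by positivity) (by rwa [div_le_one hr])
      convert this using 1
      rw [add_sub_cancel_left, smul_smul, div_mul_cancel₀ _ hr.ne']
    have n1 := shr _ _ hr1 h1 m1
    have n2 := shr _ _ hr2 h2 m2
    have n3 := shr _ _ hr3 h3 m3
    have n4 := shr _ _ hr4 h4 m4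
    refine ⟨s, hs, h5, fun p q p1 p2 q1 q2 => ?_⟩
    have hd : 0 < 2 * K - 1 / 2 := by linarith
    obtain ⟨α, α0, α1, rfl⟩ : ∃ α : ℝ, 0 ≤ α ∧ α ≤ 1 ∧ p = (1 - α) * (1 / 2) + α * (2 * K) :=
      ⟨(p - 1 / 2) / (2 * K - 1 / 2), div_nonneg (by linarith) hd.le,
        by rw [div_le_one hd]; linarith, by
          have := div_mul_cancel₀ (p - 1 / 2) hd.ne'
          linarith⟩
    obtain ⟨β, β0, β1, rfl⟩ : ∃ β : ℝ, 0 ≤ β ∧ β ≤ 1 ∧ q = (1 - β) * (1 / 2) + β * (2 * K) :=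
      ⟨(q - 1 / 2) / (2 * K - 1 / 2), div_nonneg (by linarith) hd.le,
        by rw [div_le_one hd]; linarith, by
          have := div_mul_cancel₀ (q - 1 / 2) hd.ne'
          linarith⟩
    have a1 := hconv n1 n3 (a := 1 - α) (b := α) (by linarith) α0 (by ring)
    have a2 := hconv n2 n4 (a := 1 - α) (b := α) (by linarith) α0 (by ring)
    have a3 := hconv a1 a2 (a := 1 - β) (b := β) (by linarith) β0 (by ring)
    convert a3 using 1
    module
  obtain ⟨s, hs, hs2, hbox⟩ := hbox
  have hcoF : ∀ p q : ℝ, -F x0 + F (x0 + (p • E1 + q • E2)) = p := by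
    intro p q; simp [F1, F2]
  have hcoG : ∀ p q : ℝ, -G x0 + G (x0 + (p • E1 + q • E2)) = q := by
    intro p q; simp [G1, G2]
  have hinj : ∀ p q p' q' : ℝ, x0 + (p • E1 + q • E2) = x0 + (p' • E1 + q' • E2) →
      p = p' ∧ q = q' := by
    intro p q p' q' h
    exact ⟨by rw [← hcoF p q, h, hcoF], by rw [← hcoG p q, h, hcoG]⟩
  have hoe : x0 + (E1 + E2) = x0 + ((1 : ℝ) • E1 + (1 : ℝ) • E2) := by simp
  have hxC := hbox 1 K (by norm_num) (by linarith) (by linarith) (by linarith)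
  have hyC := hbox K 1 (by linarith) (by linarith) (by norm_num) (by linarith)
  have hzC := hbox 1 1 (by norm_num) (by linarith) (by norm_num) (by linarith)
  -- lower bounds
  have hxy : hDist C (x0 + ((s * 1) • E1 + (s * K) • E2)) (x0 + ((s * K) • E1 + (s * 1) • E2))
      ≥ Real.log K := by
    have := hd_low hconv hopen hbdd hxC hyC (by
      intro h
      have := (hinj _ _ _ _ h).1
      nlinarith) G F _ _ hG hF
    rw [hcoF, hcoG, hcoF, hcoG] at this
    have e : s * K * (s * K) / (s * 1 * (s * 1)) = K ^ 2 := by field_simp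
    rw [e, Real.log_pow] at this
    push_cast at this
    linarith
  have hzo : hDist C (x0 + ((s * 1) • E1 + (s * 1) • E2)) (x0 + (E1 + E2))
      ≥ 1 / 2 * Real.log (1 / s) := by
    have := hd_low hconv hopen hbdd hzC ho (by
      intro h
      rw [hoe] at h
      have := (hinj _ _ _ _ h).1
      nlinarith) 0 F 1 _ (by simp) hF
    rw [hcoF, hoe, hcoF] at this
    rw [hoe]
    simpa using this
  -- upper bounds
  have hxz : hDist C (x0 + ((s * 1) • E1 + (s * K) • E2)) (x0 + ((s * 1) • E1 + (s * 1) • E2))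
      ≤ 1 / 2 * Real.log (4 * K) := by
    have hk1 : 0 < K - 1 := by linarith
    have := hd_up hconv hopen hbdd hxC hzC (by
      intro h
      have := (hinj _ _ _ _ h).2
      nlinarith) (t0 := -1) (t1 := (K - 1 / 2) / (K - 1)) (by norm_num)
      (by rw [one_lt_div hk1]; linarith)
      (by convert subset_closure (hbox 1 (2 * K - 1) (by norm_num) (by linarith) (by linarith)
            (by linarith)) using 1
          module)
      (by convert subset_closure (hbox 1 (1 / 2) (by norm_num) (by linarith) (by linarith)
            (by linarith)) using 1
          have e : (K - 1 / 2) / (K - 1) * (K - 1) = K - 1 / 2 := div_mul_cancel₀ _ hk1.ne'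
          have e2 : x0 + ((s * 1) • E1 + (s * 1) • E2) - (x0 + ((s * 1) • E1 + (s * K) • E2))
            = (K - 1) • (-s) • E2 := by module
          rw [e2, smul_smul, e]
          module)
    refine this.trans ?_
    have e : (1 - -1) * ((K - 1 / 2) / (K - 1)) / (- -1 * ((K - 1 / 2) / (K - 1) - 1))
        = 4 * K - 2 := by
      have e2 : (K - 1 / 2) / (K - 1) - 1 = (1 / 2) / (K - 1) := by field_simp; ring
      rw [e2]
      field_simp
      ring
    rw [e]
    have := Real.log_le_log (show 0 < 4 * K - 2 by linarith) (show 4 * K - 2 ≤ 4 * K by linarith)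
    linarith
  have hyz : hDist C (x0 + ((s * K) • E1 + (s * 1) • E2)) (x0 + ((s * 1) • E1 + (s * 1) • E2))
      ≤ 1 / 2 * Real.log (4 * K) := by
    have hk1 : 0 < K - 1 := by linarith
    have := hd_up hconv hopen hbdd hyC hzC (by
      intro h
      have := (hinj _ _ _ _ h).1
      nlinarith) (t0 := -1) (t1 := (K - 1 / 2) / (K - 1)) (by norm_num)
      (by rw [one_lt_div hk1]; linarith)
      (by convert subset_closure (hbox (2 * K - 1) 1 (by linarith) (by linarith) (by norm_num)
            (by linarith)) using 1
          module)
      (by convert subset_closure (hbox (1 / 2) 1 (by norm_num) (by linarith) (by linarith)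
            (by linarith)) using 1
          have e : (K - 1 / 2) / (K - 1) * (K - 1) = K - 1 / 2 := div_mul_cancel₀ _ hk1.ne'
          have e2 : x0 + ((s * 1) • E1 + (s * 1) • E2) - (x0 + ((s * K) • E1 + (s * 1) • E2))
            = (K - 1) • (-s) • E1 := by module
          rw [e2, smul_smul, e]
          module)
    refine this.trans ?_
    have e : (1 - -1) * ((K - 1 / 2) / (K - 1)) / (- -1 * ((K - 1 / 2) / (K - 1) - 1))
        = 4 * K - 2 := by
      have e2 : (K - 1 / 2) / (K - 1) - 1 = (1 / 2) / (K - 1) := by field_simp; ring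
      rw [e2]
      field_simp
      ring
    rw [e]
    have := Real.log_le_log (show 0 < 4 * K - 2 by linarith) (show 4 * K - 2 ≤ 4 * K by linarith)
    linarith
  have hs' : 0 < 1 - s / 2 := by linarith
  have hpo : ∀ p q : ℝ, 1 ≤ p → p ≤ K → 1 ≤ q → q ≤ K → (p = 1 ∨ q = 1) →
      hDist C (x0 + ((s * p) • E1 + (s * q) • E2)) (x0 + (E1 + E2))
      ≤ 1 / 2 * Real.log (2 * c) + 1 / 2 * Real.log (1 / s) := by
    intro p q p1 p2 q1 q2 h
    have bd : ∀ p : ℝ, 1 ≤ p → p ≤ K → 1 / 2 ≤ (p - 1 / 2) / (1 - s / 2) ∧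
        (p - 1 / 2) / (1 - s / 2) ≤ 2 * K := by
      intro p p1 p2
      constructor
      · rw [le_div_iff₀ hs']; linarith
      · rw [div_le_iff₀ hs']; nlinarith
    have hXC := hbox _ _ (bd p p1 p2).1 (bd p p1 p2).2 (bd q q1 q2).1 (bd q q1 q2).2
    have e1 : ∀ p : ℝ, (1 - s / 2) * (s * ((p - 1 / 2) / (1 - s / 2))) = s * p - s / 2 := by
      intro p
      have := div_mul_cancel₀ (p - 1 / 2) hs'.ne'
      linear_combination s * this
    have e2 := e1 p
    have e3 := e1 q
    have hne : x0 + ((s * ((p - 1 / 2) / (1 - s / 2))) • E1 +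
        (s * ((q - 1 / 2) / (1 - s / 2))) • E2) ≠ x0 + (E1 + E2) := by
      intro h'
      rw [hoe] at h'
      obtain ⟨i1, i2⟩ := hinj _ _ _ _ h'
      rw [i1] at e2
      rw [i2] at e3
      rcases h with rfl | rfl <;> linarith
    have := hup _ (subset_closure hXC) hne (s / 2) (by linarith) (by linarith)
    generalize s * ((p - 1 / 2) / (1 - s / 2)) = P at *
    generalize s * ((q - 1 / 2) / (1 - s / 2)) = Q at *
    have ex : x0 + (P • E1 + Q • E2) + (s / 2) • (x0 + (E1 + E2) - (x0 + (P • E1 + Q • E2)))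
        = x0 + ((s * p) • E1 + (s * q) • E2) := by
      have e4 : s * p = (1 - s / 2) * P + s / 2 := by linarith
      have e5 : s * q = (1 - s / 2) * Q + s / 2 := by linarith
      rw [e4, e5]
      module
    rw [ex] at this
    refine this.trans (le_of_eq ?_)
    rw [← mul_add, ← Real.log_mul (by positivity) (by positivity)]
    congr 2
    field_simp
  have hxo := hpo 1 K le_rfl (by linarith) (by linarith) le_rfl (Or.inl rfl)
  have hyo := hpo K 1 (by linarith) le_rfl le_rfl (by linarith) (Or.inr rfl)
  have h4K : Real.log (4 * K) = Real.log 4 + Real.log K :=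
    Real.log_mul (by norm_num) (by linarith)
  rcases four_pt hhyp hxC hyC hzC ho with h | h <;> linarith

theorem supp_strict {C : Set (Euc 2)} (hopen : IsOpen C) {x0 : Euc 2} (l : Euc 2 →L[ℝ] ℝ)
    (hl : ‖l‖ = 1) (h : ∀ y ∈ C, l y ≤ l x0) : ∀ y ∈ C, l y < l x0 := by
  intro y hy
  have hl0 : l ≠ 0 := by rintro rfl; simp at hl
  obtain ⟨v, hv⟩ : ∃ v, l v ≠ 0 := by
    by_contra! h'
    exact hl0 (ContinuousLinearMap.ext h')
  have hcont : Continuous (fun t : ℝ => y + t • (l v • v)) := by fun_prop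
  have ev : ∀ᶠ t : ℝ in nhds 0, y + t • (l v • v) ∈ C := by
    apply hcont.continuousAt.eventually_mem
    apply hopen.mem_nhds
    simpa using hy
  obtain ⟨t, ht, ht0⟩ := ((ev.filter_mono (nhdsWithin_le_nhds (s := Ioi 0))).and
    self_mem_nhdsWithin).exists
  have ht0 : 0 < t := ht0
  have := h _ ht
  simp only [map_add, map_smul, smul_eq_mul] at this
  have : 0 < t * (l v * l v) := mul_pos ht0 (mul_self_pos.2 hv)
  linarith

theorem c1_unique {C : Set (Euc 2)} (hconv : Convex ℝ C) (hopen : IsOpen C)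
    (hbdd : Bornology.IsBounded C) (hne : C.Nonempty) {δ : ℝ}
    (hhyp : IsDeltaHyp C δ) {x0 : Euc 2} (hx0 : x0 ∈ closure C) (l1 l2 : Euc 2 →L[ℝ] ℝ)
    (n1 : ‖l1‖ = 1) (n2 : ‖l2‖ = 1) (h1 : ∀ y ∈ C, l1 y < l1 x0) (h2 : ∀ y ∈ C, l2 y < l2 x0) :
    l1 = l2 := by
  by_contra hl
  obtain ⟨o, ho⟩ := hne
  obtain ⟨u, rfl⟩ : ∃ u, o = x0 + u := ⟨o - x0, by abel⟩
  have hA : l1 u < 0 := by have := h1 _ ho; rw [map_add] at this; linarith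
  have hB : l2 u < 0 := by have := h2 _ ho; rw [map_add] at this; linarith
  have hinj : ∀ n, l1 n = 0 → l2 n = 0 → n = 0 := by
    intro n hn1 hn2
    by_contra hn
    have hli : LinearIndependent ℝ ![u, n] := by
      rw [LinearIndependent.pair_iff]
      intro a b hab
      have := congrArg l1 hab
      simp only [map_add, map_smul, smul_eq_mul, hn1, mul_zero, add_zero, map_zero] at this
      have ha : a = 0 := by
        rcases mul_eq_zero.1 this with h | h
        · exact h
        · linarith
      subst ha
      simp only [zero_smul, zero_add] at hab
      exact ⟨rfl, (smul_eq_zero.1 hab).resolve_right hn⟩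
    have hsp := hli.span_eq_top_of_card_eq_finrank (by simp)
    have heq : l1 = (l1 u / l2 u) • l2 := by
      apply ContinuousLinearMap.coe_injective
      apply LinearMap.ext_on hsp
      rintro v ⟨i, rfl⟩
      fin_cases i
      · simp [hB.ne]
      · simp [hn1, hn2]
    have hr : 0 < l1 u / l2 u := div_pos_of_neg_of_neg hA hB
    have : ‖l1‖ = (l1 u / l2 u) * ‖l2‖ := by
      conv_lhs => rw [heq]
      rw [norm_smul, Real.norm_eq_abs, abs_of_pos hr]
    rw [n1, n2, mul_one] at this
    rw [← this, one_smul] at heq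
    exact hl heq
  obtain ⟨w, hw1, hw2⟩ : ∃ w, l1 w = 1 ∧ l2 w = -1 := by
    let L : Euc 2 →ₗ[ℝ] ℝ × ℝ := (l1 : Euc 2 →ₗ[ℝ] ℝ).prod (l2 : Euc 2 →ₗ[ℝ] ℝ)
    have hLi : Function.Injective L := by
      rw [injective_iff_map_eq_zero]
      intro a ha
      have := Prod.ext_iff.1 ha
      exact hinj a this.1 this.2
    have hLs := (LinearMap.injective_iff_surjective_of_finrank_eq_finrank (f := L) (by simp)).1 hLi
    obtain ⟨w, hw⟩ := hLs (1, -1)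
    have := Prod.ext_iff.1 hw
    exact ⟨w, this.1, this.2⟩
  -- tangent cone
  let T : Set (Euc 2) := {v | ∃ r : ℝ, 0 < r ∧ x0 + r • v ∈ C}
  have T1 : ∀ v ∈ T, l1 v < 0 := by
    rintro v ⟨r, hr, hv⟩
    have := h1 _ hv
    simp only [map_add, map_smul, smul_eq_mul] at this
    by_contra! h
    nlinarith
  have T2 : ∀ v ∈ T, l2 v < 0 := by
    rintro v ⟨r, hr, hv⟩
    have := h2 _ hv
    simp only [map_add, map_smul, smul_eq_mul] at this
    by_contra! h
    nlinarith
  have Tsmul : ∀ v ∈ T, ∀ k : ℝ, 0 < k → k • v ∈ T := by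
    rintro v ⟨r, hr, hv⟩ k hk
    refine ⟨r / k, by positivity, ?_⟩
    rwa [smul_smul, div_mul_cancel₀ _ hk.ne']
  have Tadd : ∀ v ∈ T, ∀ v' ∈ T, v + v' ∈ T := by
    rintro v ⟨r, hr, hv⟩ v' ⟨r', hr', hv'⟩
    refine ⟨r * r' / (r + r'), by positivity, ?_⟩
    have := hconv hv hv' (a := r' / (r + r')) (b := r / (r + r')) (by positivity) (by positivity)
      (by field_simp; ring)
    convert this using 1
    have e1 : r * r' / (r + r') = r' / (r + r') * r := by ring
    have e3 : r * r' / (r + r') = r / (r + r') * r' := by ring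
    have e2 : r' / (r + r') = 1 - r / (r + r') := by field_simp; ring
    rw [smul_add, smul_add, smul_add, smul_smul, smul_smul, ← e1, ← e3, e2]
    module
  let S : Set ℝ := {t | u + t • w ∈ T}
  have hSo : IsOpen S := by
    rw [isOpen_iff_mem_nhds]
    rintro t ⟨r, hr, ht⟩
    have hcont : Continuous (fun t : ℝ => x0 + r • (u + t • w)) := by fun_prop
    filter_upwards [hcont.continuousAt.eventually_mem (hopen.mem_nhds ht)] with t' ht'
    exact ⟨r, hr, ht'⟩
  have h0 : (0 : ℝ) ∈ S := ⟨1, one_pos, by simpa using ho⟩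
  have hba : BddAbove S := ⟨-l1 u, fun t ht => by
    have := T1 _ ht
    simp only [map_add, map_smul, smul_eq_mul, hw1] at this
    linarith⟩
  have hbb : BddBelow S := ⟨l2 u, fun t ht => by
    have := T2 _ ht
    simp only [map_add, map_smul, smul_eq_mul, hw2] at this
    linarith⟩
  have hlt : ∀ t ∈ S, sInf S < t ∧ t < sSup S := by
    intro t ht
    obtain ⟨ε, hε, hb⟩ := Metric.isOpen_iff.1 hSo t ht
    have a1 : t + ε / 2 ∈ S := hb (by
      rw [Metric.mem_ball, Real.dist_eq, abs_lt]; constructor <;> linarith)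
    have a2 : t - ε / 2 ∈ S := hb (by
      rw [Metric.mem_ball, Real.dist_eq, abs_lt]; constructor <;> linarith)
    have := le_csSup hba a1
    have := csInf_le hbb a2
    constructor <;> linarith
  have hmem : ∀ t, sInf S < t → t < sSup S → t ∈ S := by
    intro t ht1 ht2
    obtain ⟨p, hp, hpt⟩ := exists_lt_of_csInf_lt ⟨0, h0⟩ ht1
    obtain ⟨q, hq, hqt⟩ := exists_lt_of_lt_csSup ⟨0, h0⟩ ht2
    have hd : 0 < q - p := by linarith
    have := Tadd _ (Tsmul _ hp ((q - t) / (q - p)) (div_pos (by linarith) hd)) _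
      (Tsmul _ hq ((t - p) / (q - p)) (div_pos (by linarith) hd))
    change u + t • w ∈ T
    convert this using 1
    have e1 : (q - t) / (q - p) = 1 - (t - p) / (q - p) := by field_simp; ring
    have e2 : t = p + (t - p) / (q - p) * (q - p) := by rw [div_mul_cancel₀ _ hd.ne']; ring
    rw [e1]
    generalize (t - p) / (q - p) = k at *
    rw [e2]
    module
  have hm := (hlt 0 h0).1
  have hn := (hlt 0 h0).2
  obtain ⟨m, hmd⟩ : ∃ m, sInf S = -m := ⟨-sInf S, by simp⟩
  rw [hmd] at hm hlt hmem
  generalize sSup S = n at *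
  have hm : 0 < m := by linarith
  -- coordinates
  have hAB : l1 u + l2 u ≠ 0 := by linarith
  let α : Euc 2 →L[ℝ] ℝ := (1 / (l1 u + l2 u)) • (l1 + l2)
  let β : Euc 2 →L[ℝ] ℝ := l1 - (l1 u) • α
  have αd : ∀ v, α v = (l1 v + l2 v) / (l1 u + l2 u) := by
    intro v; simp [α]; ring
  have βd : ∀ v, β v = l1 v - l1 u * α v := by
    intro v; simp [β]
  have αu : α u = 1 := by rw [αd]; field_simp
  have αw : α w = 0 := by rw [αd, hw1, hw2]; simp
  have βu : β u = 0 := by rw [βd, αu]; ring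
  have βw : β w = 1 := by rw [βd, αw, hw1]; ring
  have hrep : ∀ v, v = α v • u + β v • w := by
    intro v
    have hα : α v * (l1 u + l2 u) = l1 v + l2 v := by rw [αd]; field_simp
    have hβ := βd v
    have := hinj (v - (α v • u + β v • w))
      (by simp only [map_sub, map_add, map_smul, smul_eq_mul, hw1]; linarith)
      (by simp only [map_sub, map_add, map_smul, smul_eq_mul, hw2]; linarith)
    exact sub_eq_zero.1 this
  have hTc : ∀ v ∈ T, 0 < α v ∧ -m * α v < β v ∧ β v < n * α v := by
    intro v hv
    have ha : 0 < α v := by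
      rw [αd]
      exact div_pos_of_neg_of_neg (by linarith [T1 v hv, T2 v hv]) (by linarith)
    have h3 : β v / α v ∈ S := by
      have := Tsmul v hv (1 / α v) (by positivity)
      change u + (β v / α v) • w ∈ T
      convert this using 1
      have hr := hrep v
      generalize α v = A at *
      generalize β v = B at *
      rw [hr, smul_add, smul_smul, smul_smul, one_div_mul_cancel ha.ne', one_smul]
      congr 2
      ring
    have := hlt _ h3
    rw [lt_div_iff₀ ha, div_lt_iff₀ ha] at this
    exact ⟨ha, this⟩
  have hC : ∀ y ∈ C, y - x0 ∈ T := fun y hy => ⟨1, one_pos, by simpa using hy⟩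
  have hmn : 0 < m + n := by linarith
  refine corner_core hconv hopen hbdd hhyp (x0 := x0) (E1 := (m / (m + n)) • (u + n • w))
    (E2 := (n / (m + n)) • (u - m • w)) ((1 / m) • (β + m • α)) ((1 / n) • (n • α - β))
    ?_ ?_ ?_ ?_ hx0 ?_ ?_ ?_ ?_
  · simp [αu, αw, βu, βw]; field_simp; try ring
  · simp [αu, αw, βu, βw]; try (right; ring)
  · simp [αu, αw, βu, βw]; try (right; ring)
  · simp [αu, αw, βu, βw]; field_simp; try ring
  · convert ho using 2
    have e : m / (m + n) = 1 - n / (m + n) := by field_simp; ring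
    have e2 : m / (m + n) * n = n / (m + n) * m := by ring
    rw [smul_add, smul_sub, smul_smul, smul_smul, e2, e]
    module
  · intro y hy
    have := (hTc _ (hC y hy)).2.1
    simp only [map_sub] at this
    have h3 : 0 < 1 / m * ((β y + m * α y) - (β x0 + m * α x0)) := by
      apply mul_pos (by positivity); linarith
    simp
    simp at h3
    linarith
  · intro y hy
    have := (hTc _ (hC y hy)).2.2
    simp only [map_sub] at this
    have h3 : 0 < 1 / n * ((n * α y - β y) - (n * α x0 - β x0)) := by
      apply mul_pos (by positivity); linarith
    simp
    simp at h3
    linarith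
  · intro p q hp hq
    have hden : 0 < p * m + q * n := by positivity
    have := hmem ((p - q) * (m * n) / (p * m + q * n))
      (by rw [lt_div_iff₀ hden]; nlinarith [mul_pos hp hm, mul_pos hq hn, mul_pos hm hn,
            mul_pos hp (mul_pos hm hn), mul_pos hp (mul_pos hm hm)])
      (by rw [div_lt_iff₀ hden]; nlinarith [mul_pos hq (mul_pos hn hn), mul_pos hq (mul_pos hm hn)])
    have := Tsmul _ this ((p * m + q * n) / (m + n)) (by positivity)
    have e : p • (m / (m + n)) • (u + n • w) + q • (n / (m + n)) • (u - m • w)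
        = ((p * m + q * n) / (m + n)) • (u + ((p - q) * (m * n) / (p * m + q * n)) • w) := by
      have e1 : (p * m + q * n) / (m + n) * ((p - q) * (m * n) / (p * m + q * n))
          = p * (m / (m + n)) * n - q * (n / (m + n)) * m := by
        field_simp
      have e2 : (p * m + q * n) / (m + n) = p * (m / (m + n)) + q * (n / (m + n)) := by
        ring
      rw [smul_add ((p * m + q * n) / (m + n)), smul_smul ((p * m + q * n) / (m + n)), e1, e2]
      module
    rw [e]
    exact this

theorem stmt15 (C : Set (Euc 2)) (hconv : Convex ℝ C) (hopen : IsOpen C)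
    (hbdd : Bornology.IsBounded C) (hne : C.Nonempty)
    (δ : ℝ) (hδ : 0 ≤ δ) (hhyp : IsDeltaHyp C δ) :
    HasC1Boundary C ∧ IsStrictlyConvexSet C := by
  refine ⟨fun x hx => ?_, strict_main hconv hopen hbdd hne hhyp⟩
  have hxC : x ∉ C := by
    have := hx.2
    rwa [hopen.interior_eq] at this
  obtain ⟨f, hf⟩ := geometric_hahn_banach_open_point hconv hopen hxC
  have hf0 : f ≠ 0 := by
    rintro rfl
    obtain ⟨o, ho⟩ := hne
    simpa using hf o ho
  have hfn : 0 < ‖f‖ := norm_pos_iff.2 hf0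
  have hex : ‖(‖f‖⁻¹ • f)‖ = 1 := by
    rw [norm_smul, norm_inv, norm_norm, inv_mul_cancel₀ hfn.ne']
  refine ⟨‖f‖⁻¹ • f, ⟨hex, fun y hy => ?_⟩, ?_⟩
  · have := (hf y hy).le
    simp only [smul_apply, smul_eq_mul]
    gcongr
  · rintro l ⟨hl, hl'⟩
    refine c1_unique hconv hopen hbdd hne hhyp hx.1 _ _ hl hex (supp_strict hopen l hl hl') ?_
    intro y hy
    have := hf y hy
    simp only [smul_apply, smul_eq_mul]
    gcongr
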